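/- Define g(a,b,t) := a² + b² − 2·a·b·cos t. For all real 0 ≤ l ≤ u, every real t, and all a, b with l ≤ a ≤ u and l ≤ b ≤ u, one has g(a,b,t) ≤ max( 2·u²·(1 − cos t), u² + l² − 2·u·l·cos t ). -/

import Mathlib

/-- The per-branch power function `g(a,b,t) = a² + b² − 2ab cos t`. -/
noncomputable def g (a b t : ℝ) : ℝ := a ^ 2 + b ^ 2 - 2 * a * b * Real.cos t

theorem g_comm (a b t : ℝ) : g a b t = g b a t := by
  unfold g; ring

theorem g_le_max_endpoints {l u a : ℝ} (b t : ℝ) (hla : l ≤ a) (hau : a ≤ u) :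
    g a b t ≤ max (g l b t) (g u b t) := by
  unfold g
  rcases le_total 0 (a + u - 2 * b * Real.cos t) with h | h
  · apply le_max_of_le_right
    nlinarith [mul_nonneg (sub_nonneg.2 hau) h]
  · apply le_max_of_le_left
    nlinarith [mul_nonneg (sub_nonneg.2 hla)
      (by linarith : 0 ≤ 2 * b * Real.cos t - a - l)]

theorem g_self (a t : ℝ) : g a a t = 2 * a ^ 2 * (1 - Real.cos t) := by
  unfold g; ring

theorem g_self_le_g_self {l u : ℝ} (t : ℝ) (hl : 0 ≤ l) (hlu : l ≤ u) :
    g l l t ≤ g u u t := by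
  have hc : 0 ≤ 1 - Real.cos t := sub_nonneg.2 (Real.cos_le_one t)
  rw [g_self, g_self]
  gcongr

/-- **Vertex-reduction lemma.** For `0 ≤ l ≤ u`, any angle `t`, and `a, b ∈ [l, u]`,
`g(a,b,t) ≤ max(2u²(1 − cos t), u² + l² − 2ul cos t)`. -/
theorem stmt_12 (l u t a b : ℝ) (hl : 0 ≤ l) (hlu : l ≤ u)
    (hla : l ≤ a) (hau : a ≤ u) (hlb : l ≤ b) (hbu : b ≤ u) :
    g a b t ≤ max (2 * u ^ 2 * (1 - Real.cos t))
      (u ^ 2 + l ^ 2 - 2 * u * l * Real.cos t) := by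
  have hlb' := g_le_max_endpoints l t hlb hbu
  have hub' := g_le_max_endpoints u t hlb hbu
  rw [g_comm b l] at hlb'
  rw [g_comm b u, g_comm l u] at hub'
  rw [← g_self]
  change g a b t ≤ max (g u u t) (g u l t)
  refine (g_le_max_endpoints b t hla hau).trans (max_le ?_ ?_)
  · exact hlb'.trans (max_le_max_right _ (g_self_le_g_self t hl hlu))
  · exact hub'.trans (max_comm _ _).le
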